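/- Let n ≥ 3 be an odd positive integer with binary expansion n = Σ_{0 ≤ i ≤ ν} ε_i·2^i, where ε_ν = 1 (and ε_0 = 1 since n is odd). Then s_n(x,y) = (x y)·A(ε_1)·A(ε_2)···A(ε_{ν−1})·(1,1)ᵗ, where A(0) = [[1,0],[x,y]] and A(1) = [[x,y],[0,1]], (x y) is a row vector, and (1,1)ᵗ is a column vector over ℤ[x,y]. (For ν = 1 the matrix product is empty and the statement reads s_n(x,y) = (x y)·(1,1)ᵗ = x + y.) -/

import Mathlib

open MvPolynomial Matrix

/-- Bivariate Stern polynomials: `s 1 = 1`, `s (2n) = s n`,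
`s (2n+1) = x * s n + y * s (n+1)`, where `x = X 0` and `y = X 1`
in `ℤ[x,y] = MvPolynomial (Fin 2) ℤ`. (The value at `0` is a junk value.) -/
noncomputable def sternPoly : ℕ → MvPolynomial (Fin 2) ℤ
  | 0 => 0
  | 1 => 1
  | (n + 2) =>
      if (n + 2) % 2 = 0 then sternPoly ((n + 2) / 2)
      else X 0 * sternPoly ((n + 2) / 2) + X 1 * sternPoly ((n + 2) / 2 + 1)
decreasing_by all_goals omega

/-- `Adig 0 = A(0) = [[1,0],[x,y]]` and `Adig e = A(1) = [[x,y],[0,1]]` for `e ≠ 0`. -/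
noncomputable def Adig (e : ℕ) : Matrix (Fin 2) (Fin 2) (MvPolynomial (Fin 2) ℤ) :=
  if e = 0 then !![1, 0; X 0, X 1] else !![X 0, X 1; 0, 1]

/-- The row vector `(x y)` over `ℤ[x,y]`. -/
noncomputable def rowXY : Matrix (Fin 1) (Fin 2) (MvPolynomial (Fin 2) ℤ) := !![X 0, X 1]

/-- The column vector `(1, 1)ᵗ` over `ℤ[x,y]`. -/
noncomputable def col11 : Matrix (Fin 2) (Fin 1) (MvPolynomial (Fin 2) ℤ) := !![1; 1]

theorem sternPoly_two_mul {n : ℕ} (hn : 1 ≤ n) : sternPoly (2 * n) = sternPoly n := by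
  obtain ⟨k, rfl⟩ := Nat.exists_eq_add_of_le' hn
  rw [show 2 * (k + 1) = 2 * k + 2 by ring, sternPoly, if_pos (by omega)]
  congr 1
  omega

theorem sternPoly_two_mul_add_one {n : ℕ} (hn : 1 ≤ n) :
    sternPoly (2 * n + 1) = X 0 * sternPoly n + X 1 * sternPoly (n + 1) := by
  obtain ⟨k, rfl⟩ := Nat.exists_eq_add_of_le' hn
  rw [show 2 * (k + 1) + 1 = (2 * k + 1) + 2 by ring, sternPoly, if_neg (by omega),
    show (2 * k + 1 + 2) / 2 = k + 1 by omega]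

theorem Adig_mul_sternPoly_column {n e : ℕ} (hn : 1 ≤ n) (he : e < 2) :
    Adig e * !![sternPoly n; sternPoly (n + 1)]
      = !![sternPoly (2 * n + e); sternPoly (2 * n + e + 1)] := by
  have h : sternPoly (2 * n + 1 + 1) = sternPoly (n + 1) :=
    sternPoly_two_mul (n := n + 1) (by omega)
  interval_cases e <;> ext i j : 2 <;> fin_cases i <;> fin_cases j <;>
    simp [Adig, Matrix.mul_apply, Fin.sum_univ_two, sternPoly_two_mul hn,
      sternPoly_two_mul_add_one hn, h]

theorem prod_Adig_digits_mul_col11 {n : ℕ} (hn : 1 ≤ n) :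
    ((Nat.digits 2 n).dropLast.map Adig).prod * col11
      = !![sternPoly n; sternPoly (n + 1)] := by
  induction n using Nat.strong_induction_on with
  | _ n ih =>
    obtain rfl | h := hn.eq_or_lt
    · simp [col11, sternPoly]
    · have hne : Nat.digits 2 (n / 2) ≠ [] :=
        Nat.digits_ne_nil_iff_ne_zero.mpr (by omega)
      rw [Nat.digits_def' one_lt_two hn, List.dropLast_cons_of_ne_nil hne, List.map_cons,
        List.prod_cons, Matrix.mul_assoc, ih _ (by omega) (by omega),
        Adig_mul_sternPoly_column (by omega) (Nat.mod_lt _ two_pos), Nat.div_add_mod]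

/-- For odd `n ≥ 3` with binary digits `Nat.digits 2 n = [ε_0, ε_1, …, ε_ν]` (so
`ε_ν = 1` and `ε_0 = 1`), we have `s_n(x,y) = (x y)·A(ε_1)···A(ε_{ν-1})·(1,1)ᵗ`. -/
theorem sternPoly_eq_matrix_prod (n : ℕ) (hn : 3 ≤ n) (hodd : Odd n) :
    sternPoly n
      = (rowXY * (((Nat.digits 2 n).drop 1).dropLast.map Adig).prod * col11) 0 0 := by
  obtain ⟨k, rfl⟩ := hodd
  have hk : 1 ≤ k := by omega
  rw [Nat.digits_def' one_lt_two (by omega), List.drop_one, List.tail_cons,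
    show (2 * k + 1) / 2 = k by omega, Matrix.mul_assoc, prod_Adig_digits_mul_col11 hk,
    sternPoly_two_mul_add_one hk]
  simp [rowXY, Matrix.mul_apply, Fin.sum_univ_two]
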